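/- arXiv:math/0302192 — 5 statements merged into one kernel-verified Lean document; each statement's English description precedes it below -/
import Mathlib

section
/- Let (Z,A,S) be a normal bivariate Birkhoff interpolation scheme in which Z is (p,q)-rectangular, and suppose A contains no mixed derivative, i.e. every (i,j)∈A has i=0 or j=0. Then (Z,A,S) is regular if and only if the univariate schemes (Z_x, A_x, S_x) and (Z_y, A_y, S_y) are regular and S = T^{p,q}, where T = R(|A_x|−1, 0) ∪ R(0, |A_y|−1). -/
open Finset

/-- A finite subset of `ℤ≥0²` is a *lower set* if it is closed under
coordinatewise decrease. -/
def IsLower (S : Finset (ℕ × ℕ)) : Prop :=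
  ∀ u v, (u, v) ∈ S → ∀ i j, i ≤ u → j ≤ v → (i, j) ∈ S

/-- The value at `(x,y)` of `∂^{i+j}P/∂x^i∂y^j`, where `P` is the polynomial
with coefficients `a` supported on `S`. -/
noncomputable def derivAt (S : Finset (ℕ × ℕ)) (a : ℕ × ℕ → ℝ) (i j : ℕ) (x y : ℝ) : ℝ :=
  ∑ uv ∈ S, a uv * (uv.1.descFactorial i : ℝ) * (uv.2.descFactorial j : ℝ) *
      x ^ (uv.1 - i) * y ^ (uv.2 - j)

/-- The bivariate Birkhoff scheme `(Z,A,S)` is *regular*: every interpolation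
problem has a unique solution in `P_S` (polynomials supported on `S`). -/
def Regular (Z : Finset (ℝ × ℝ)) (A S : Finset (ℕ × ℕ)) : Prop :=
  ∀ c : ℕ × ℕ → ℝ × ℝ → ℝ, ∃! a : ℕ × ℕ → ℝ,
    (∀ uv, uv ∉ S → a uv = 0) ∧
    ∀ z ∈ Z, ∀ ij ∈ A, derivAt S a ij.1 ij.2 z.1 z.2 = c ij z

/-- The scheme `(Z,A,S)` is *solvable*: every interpolation problem has at
least one solution in `P_S`. -/
def Solvable (Z : Finset (ℝ × ℝ)) (A S : Finset (ℕ × ℕ)) : Prop :=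
  ∀ c : ℕ × ℕ → ℝ × ℝ → ℝ, ∃ a : ℕ × ℕ → ℝ,
    (∀ uv, uv ∉ S → a uv = 0) ∧
    ∀ z ∈ Z, ∀ ij ∈ A, derivAt S a ij.1 ij.2 z.1 z.2 = c ij z

/-- `Z ⊂ ℝ²` is a `(p,q)`-rectangular set of nodes. -/
def IsRect (p q : ℕ) (Z : Finset (ℝ × ℝ)) : Prop :=
  ∃ x : Fin (p + 1) → ℝ, ∃ y : Fin (q + 1) → ℝ,
    Function.Injective x ∧ Function.Injective y ∧
    Z = (Finset.univ : Finset (Fin (p + 1) × Fin (q + 1))).image (fun ij => (x ij.1, y ij.2))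

/-- `B_x = {i : (i,0) ∈ B}`. -/
def setX (B : Finset (ℕ × ℕ)) : Finset ℕ := (B.filter fun ij => ij.2 = 0).image Prod.fst

/-- `B_y = {j : (0,j) ∈ B}`. -/
def setY (B : Finset (ℕ × ℕ)) : Finset ℕ := (B.filter fun ij => ij.1 = 0).image Prod.snd

/-- `B_x[β] = {α : (α,β) ∈ B}`. -/
def sliceX (B : Finset (ℕ × ℕ)) (b : ℕ) : Finset ℕ := (B.filter fun ij => ij.2 = b).image Prod.fst

/-- `B_y[α] = {β : (α,β) ∈ B}`. -/
def sliceY (B : Finset (ℕ × ℕ)) (a : ℕ) : Finset ℕ := (B.filter fun ij => ij.1 = a).image Prod.snd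

/-- Projection of the nodes on the OX axis. -/
noncomputable def nodesX (Z : Finset (ℝ × ℝ)) : Finset ℝ := Z.image Prod.fst

/-- Projection of the nodes on the OY axis. -/
noncomputable def nodesY (Z : Finset (ℝ × ℝ)) : Finset ℝ := Z.image Prod.snd

/-- The rectangle `R(u,v) = {(i,j) : i ≤ u, j ≤ v}`. -/
def rect (u v : ℕ) : Finset (ℕ × ℕ) := Finset.range (u + 1) ×ˢ Finset.range (v + 1)

/-- The blow-up `R^{p,q} = {(α,β) : (⌊α/(p+1)⌋, ⌊β/(q+1)⌋) ∈ R}`. -/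
def blowup (p q : ℕ) (R : Finset (ℕ × ℕ)) : Finset (ℕ × ℕ) :=
  (R ×ˢ (Finset.range (p + 1) ×ˢ Finset.range (q + 1))).image
    (fun x => ((p + 1) * x.1.1 + x.2.1, (q + 1) * x.1.2 + x.2.2))

/-- `n_{p,q}(L)`: number of `(α,β) ∈ L` with `(p+1) ∣ α` and `(q+1) ∣ β`. -/
def npq (p q : ℕ) (L : Finset (ℕ × ℕ)) : ℕ :=
  (L.filter fun ab => (p + 1) ∣ ab.1 ∧ (q + 1) ∣ ab.2).card

/-- Value at `x` of the `i`-th derivative of the univariate polynomial with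
coefficients `a` supported on `S`. -/
noncomputable def derivAt1 (S : Finset ℕ) (a : ℕ → ℝ) (i : ℕ) (x : ℝ) : ℝ :=
  ∑ u ∈ S, a u * (u.descFactorial i : ℝ) * x ^ (u - i)

/-- Regularity of the univariate Birkhoff scheme `(W,A,S)`. -/
def Regular1 (W : Finset ℝ) (A S : Finset ℕ) : Prop :=
  ∀ c : ℕ → ℝ → ℝ, ∃! a : ℕ → ℝ,
    (∀ u, u ∉ S → a u = 0) ∧
    ∀ w ∈ W, ∀ i ∈ A, derivAt1 S a i w = c i w

/-- `(A,S)` is almost regular with respect to `(p,q)`-rectangular sets of nodes. -/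
def AlmostRegular (p q : ℕ) (A S : Finset (ℕ × ℕ)) : Prop :=
  ∃ Z : Finset (ℝ × ℝ), IsRect p q Z ∧ Regular Z A S


section LinearSystems

variable {ι κ : Type*} (S : Finset ι) (K : Finset κ) (M : κ → ι → ℝ)

/-- The linear map sending the unknowns indexed by `S` to the equations indexed by `K`. -/
noncomputable def systemMap : (S → ℝ) →ₗ[ℝ] (K → ℝ) :=
  Matrix.mulVecLin (Matrix.of fun (k : K) (u : S) => M k u)

variable {S K M}

lemma systemMap_restrict (a : ι → ℝ) (k : K) :
    systemMap S K M (fun u => a u) k = ∑ u ∈ S, a u * M k u := by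
  rw [← Finset.sum_coe_sort S]
  simp [systemMap, Matrix.mulVec, dotProduct, mul_comm]

lemma exists_extend (b : S → ℝ) :
    ∃ a : ι → ℝ, (∀ u, u ∉ S → a u = 0) ∧ (fun u : S => a u) = b := by
  classical
  refine ⟨fun u => if h : u ∈ S then b ⟨u, h⟩ else 0, fun u hu => by simp [hu], ?_⟩
  funext u
  simp

lemma card_le_of_solvable
    (h : ∀ c : κ → ℝ, ∃ a : ι → ℝ, ∀ k ∈ K, ∑ u ∈ S, a u * M k u = c k) :
    K.card ≤ S.card := by
  have hsurj : Function.Surjective (systemMap S K M) := by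
    intro c
    obtain ⟨c', -, rfl⟩ := exists_extend c
    obtain ⟨a, ha⟩ := h c'
    exact ⟨fun u => a u, funext fun k => by rw [systemMap_restrict, ha k k.2]⟩
  simpa using LinearMap.finrank_le_finrank_of_surjective hsurj

lemma systemMap_injective
    (h : ∀ a : ι → ℝ, (∀ u, u ∉ S → a u = 0) → (∀ k ∈ K, ∑ u ∈ S, a u * M k u = 0) → a = 0) :
    Function.Injective (systemMap S K M) := by
  rw [injective_iff_map_eq_zero]
  intro b hb
  obtain ⟨a, ha, rfl⟩ := exists_extend b
  have := h a ha fun k hk => by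
    rw [← systemMap_restrict a ⟨k, hk⟩, hb]
    rfl
  subst this
  rfl

lemma card_le_of_trivial_kernel
    (h : ∀ a : ι → ℝ, (∀ u, u ∉ S → a u = 0) → (∀ k ∈ K, ∑ u ∈ S, a u * M k u = 0) → a = 0) :
    S.card ≤ K.card := by
  simpa using LinearMap.finrank_le_finrank_of_injective (systemMap_injective h)

lemma existsUnique_of_trivial_kernel (hcard : S.card = K.card)
    (h : ∀ a : ι → ℝ, (∀ u, u ∉ S → a u = 0) → (∀ k ∈ K, ∑ u ∈ S, a u * M k u = 0) → a = 0)
    (c : κ → ℝ) :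
    ∃! a : ι → ℝ, (∀ u, u ∉ S → a u = 0) ∧ ∀ k ∈ K, ∑ u ∈ S, a u * M k u = c k := by
  have hinj := systemMap_injective h
  have hsurj := (LinearMap.injective_iff_surjective_of_finrank_eq_finrank
    (f := systemMap S K M) (by simpa using hcard)).1 hinj
  obtain ⟨b, hb⟩ := hsurj fun k => c k
  obtain ⟨a, ha, rfl⟩ := exists_extend b
  have hac : ∀ k ∈ K, ∑ u ∈ S, a u * M k u = c k := fun k hk => by
    rw [← systemMap_restrict a ⟨k, hk⟩, hb]
  refine ⟨a, ⟨ha, hac⟩, fun a' ⟨ha', hac'⟩ => ?_⟩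
  refine sub_eq_zero.1 (h (a' - a) (fun u hu => by simp [ha u hu, ha' u hu]) fun k hk => ?_)
  simp [sub_mul, Finset.sum_sub_distrib, hac k hk, hac' k hk]

end LinearSystems

section Schemes

lemma derivAt_eq_sum (S : Finset (ℕ × ℕ)) (a : ℕ × ℕ → ℝ) (i j : ℕ) (x y : ℝ) :
    derivAt S a i j x y = ∑ uv ∈ S, a uv * ((uv.1.descFactorial i : ℝ) *
      (uv.2.descFactorial j : ℝ) * x ^ (uv.1 - i) * y ^ (uv.2 - j)) := by
  simp only [derivAt, mul_assoc]

lemma derivAt1_eq_sum (S : Finset ℕ) (a : ℕ → ℝ) (i : ℕ) (x : ℝ) :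
    derivAt1 S a i x = ∑ u ∈ S, a u * ((u.descFactorial i : ℝ) * x ^ (u - i)) := by
  simp only [derivAt1, mul_assoc]

lemma Regular.eq_zero {Z : Finset (ℝ × ℝ)} {A S : Finset (ℕ × ℕ)} (h : Regular Z A S)
    {a : ℕ × ℕ → ℝ} (ha : ∀ uv, uv ∉ S → a uv = 0)
    (h0 : ∀ z ∈ Z, ∀ ij ∈ A, derivAt S a ij.1 ij.2 z.1 z.2 = 0) : a = 0 :=
  (h fun _ _ => 0).unique ⟨ha, h0⟩ ⟨fun _ _ => rfl, by simp [derivAt]⟩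

lemma Regular1.eq_zero {W : Finset ℝ} {A S : Finset ℕ} (h : Regular1 W A S)
    {a : ℕ → ℝ} (ha : ∀ u, u ∉ S → a u = 0)
    (h0 : ∀ w ∈ W, ∀ i ∈ A, derivAt1 S a i w = 0) : a = 0 :=
  (h fun _ _ => 0).unique ⟨ha, h0⟩ ⟨fun _ _ => rfl, by simp [derivAt1]⟩

lemma regular_of_trivial_kernel {Z : Finset (ℝ × ℝ)} {A S : Finset (ℕ × ℕ)}
    (hcard : S.card = Z.card * A.card)
    (h : ∀ a : ℕ × ℕ → ℝ, (∀ uv, uv ∉ S → a uv = 0) →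
      (∀ z ∈ Z, ∀ ij ∈ A, derivAt S a ij.1 ij.2 z.1 z.2 = 0) → a = 0) :
    Regular Z A S := by
  intro c
  simp only [derivAt_eq_sum] at h ⊢
  have := existsUnique_of_trivial_kernel (S := S) (K := Z ×ˢ A)
    (M := fun k uv => (uv.1.descFactorial k.2.1 : ℝ) * (uv.2.descFactorial k.2.2 : ℝ) *
      k.1.1 ^ (uv.1 - k.2.1) * k.1.2 ^ (uv.2 - k.2.2)) (by rw [hcard, Finset.card_product])
    (fun a ha h0 => h a ha fun z hz ij hij => h0 (z, ij) (Finset.mk_mem_product hz hij))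
    (fun k => c k.2 k.1)
  refine (existsUnique_congr fun a => and_congr_right fun _ => ?_).1 this
  exact ⟨fun H w hw i hi => H (w, i) (Finset.mk_mem_product hw hi),
    fun H k hk => H k.1 (Finset.mem_product.1 hk).1 k.2 (Finset.mem_product.1 hk).2⟩

lemma regular1_of_trivial_kernel {W : Finset ℝ} {A S : Finset ℕ}
    (hcard : S.card = W.card * A.card)
    (h : ∀ a : ℕ → ℝ, (∀ u, u ∉ S → a u = 0) →
      (∀ w ∈ W, ∀ i ∈ A, derivAt1 S a i w = 0) → a = 0) :
    Regular1 W A S := by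
  intro c
  simp only [derivAt1_eq_sum] at h ⊢
  have := existsUnique_of_trivial_kernel (S := S) (K := W ×ˢ A)
    (M := fun k u => (u.descFactorial k.2 : ℝ) * k.1 ^ (u - k.2))
    (by rw [hcard, Finset.card_product])
    (fun a ha h0 => h a ha fun w hw i hi => h0 (w, i) (Finset.mk_mem_product hw hi))
    (fun k => c k.2 k.1)
  refine (existsUnique_congr fun a => and_congr_right fun _ => ?_).1 this
  exact ⟨fun H w hw i hi => H (w, i) (Finset.mk_mem_product hw hi),
    fun H k hk => H k.1 (Finset.mem_product.1 hk).1 k.2 (Finset.mem_product.1 hk).2⟩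

lemma card_le_of_trivial_kernel1 {W : Finset ℝ} {A S : Finset ℕ}
    (h : ∀ a : ℕ → ℝ, (∀ u, u ∉ S → a u = 0) →
      (∀ w ∈ W, ∀ i ∈ A, derivAt1 S a i w = 0) → a = 0) :
    S.card ≤ W.card * A.card := by
  simp only [derivAt1_eq_sum] at h
  rw [← Finset.card_product]
  exact card_le_of_trivial_kernel
    (M := fun k u => (u.descFactorial k.2 : ℝ) * k.1 ^ (u - k.2))
    (fun a ha h0 => h a ha fun w hw i hi => h0 (w, i) (Finset.mk_mem_product hw hi))

end Schemes

section Swap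

lemma derivAt_image_swap (S : Finset (ℕ × ℕ)) (a : ℕ × ℕ → ℝ) (i j : ℕ) (x y : ℝ) :
    derivAt (S.image Prod.swap) a i j x y = derivAt S (a ∘ Prod.swap) j i y x := by
  rw [derivAt, Finset.sum_image Prod.swap_injective.injOn]
  refine Finset.sum_congr rfl fun uv _ => ?_
  simp only [Prod.fst_swap, Prod.snd_swap, Function.comp]
  ring

lemma mem_image_swap {α β : Type*} [DecidableEq α] [DecidableEq β] {B : Finset (α × β)}
    {u : β × α} : u ∈ B.image Prod.swap ↔ u.swap ∈ B := by
  simp only [Finset.mem_image]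
  exact ⟨fun ⟨v, hv, h⟩ => by rw [← h]; simpa using hv, fun h => ⟨_, h, Prod.swap_swap u⟩⟩

lemma Regular.image_swap {Z : Finset (ℝ × ℝ)} {A S : Finset (ℕ × ℕ)} (h : Regular Z A S) :
    Regular (Z.image Prod.swap) (A.image Prod.swap) (S.image Prod.swap) := by
  intro c
  obtain ⟨a, ⟨ha, hc⟩, hu⟩ := h fun ij z => c ij.swap z.swap
  refine ⟨a ∘ Prod.swap, ⟨fun uv huv => ha _ (mt mem_image_swap.2 huv), ?_⟩, ?_⟩
  · intro z hz ij hij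
    rw [derivAt_image_swap]
    simpa [Function.comp_assoc] using
      hc _ (mem_image_swap.1 hz) _ (mem_image_swap.1 hij)
  · rintro b ⟨hb, hbc⟩
    rw [← hu (b ∘ Prod.swap) ⟨fun uv huv => hb _ (by rwa [mem_image_swap, Prod.swap_swap]), ?_⟩]
    · simp [Function.comp_assoc]
    · intro z hz ij hij
      have := hbc z.swap (by rwa [mem_image_swap, Prod.swap_swap]) ij.swap
        (by rwa [mem_image_swap, Prod.swap_swap])
      rwa [derivAt_image_swap] at this

lemma IsLower.image_swap {S : Finset (ℕ × ℕ)} (hS : IsLower S) : IsLower (S.image Prod.swap) := by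
  intro u v huv i j hi hj
  rw [mem_image_swap] at huv ⊢
  exact hS v u huv j i hj hi

lemma mem_setX {B : Finset (ℕ × ℕ)} {i : ℕ} : i ∈ setX B ↔ (i, 0) ∈ B := by
  simp [setX]

lemma mem_setY {B : Finset (ℕ × ℕ)} {j : ℕ} : j ∈ setY B ↔ (0, j) ∈ B := by
  simp [setY]

lemma setX_image_swap (B : Finset (ℕ × ℕ)) : setX (B.image Prod.swap) = setY B := by
  ext i
  rw [mem_setX, mem_setY, mem_image_swap, Prod.swap_prod_mk]

end Swap

section Rows

open Polynomial

/-- The coefficient of `x^α`, as a polynomial in `y`, of the bivariate polynomial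
with coefficients `a` supported on `S`. -/
noncomputable def rowPoly (S : Finset (ℕ × ℕ)) (a : ℕ × ℕ → ℝ) (α : ℕ) : ℝ[X] :=
  ∑ uv ∈ S with uv.1 = α, monomial uv.2 (a uv)

lemma coeff_rowPoly {S : Finset (ℕ × ℕ)} {a : ℕ × ℕ → ℝ} (ha : ∀ uv, uv ∉ S → a uv = 0)
    (α β : ℕ) : (rowPoly S a α).coeff β = a (α, β) := by
  simp only [rowPoly, finsetSum_coeff, coeff_monomial]
  rw [Finset.sum_eq_single (α, β)]
  · simp
  · rintro ⟨u, v⟩ huv hne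
    simp only [Finset.mem_filter] at huv
    obtain ⟨-, rfl⟩ := huv
    rw [if_neg]
    rintro rfl
    exact hne rfl
  · intro h
    simp only [if_true]
    exact ha _ fun hS => h (by simpa using hS)

lemma derivAt_zero_right {S : Finset (ℕ × ℕ)} {U : Finset ℕ} (hU : ∀ uv ∈ S, uv.1 ∈ U)
    (a : ℕ × ℕ → ℝ) (i : ℕ) (x y : ℝ) :
    derivAt S a i 0 x y = derivAt1 U (fun α => (rowPoly S a α).eval y) i x := by
  rw [derivAt, derivAt1, ← Finset.sum_fiberwise_of_maps_to hU]
  refine Finset.sum_congr rfl fun α _ => ?_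
  rw [rowPoly, eval_finsetSum, Finset.sum_mul, Finset.sum_mul]
  refine Finset.sum_congr rfl fun uv huv => ?_
  obtain ⟨-, rfl⟩ := Finset.mem_filter.1 huv
  simp only [eval_monomial, Nat.descFactorial_zero, Nat.cast_one, tsub_zero]
  ring

lemma IsLower.fst_mem_setX {S : Finset (ℕ × ℕ)} (hS : IsLower S) :
    ∀ uv ∈ S, uv.1 ∈ setX S :=
  fun uv huv => mem_setX.2 (hS uv.1 uv.2 huv _ _ le_rfl (Nat.zero_le _))

lemma trivial_kernel_setX {X Y : Finset ℝ} {A S : Finset (ℕ × ℕ)}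
    (hS : IsLower S) (h : Regular (X ×ˢ Y) A S) (b : ℕ → ℝ) (hb : ∀ u, u ∉ setX S → b u = 0)
    (h0 : ∀ w ∈ X, ∀ i ∈ setX A, derivAt1 (setX S) b i w = 0) : b = 0 := by
  set a : ℕ × ℕ → ℝ := fun uv => if uv.2 = 0 then b uv.1 else 0
  have ha : ∀ uv, uv ∉ S → a uv = 0 := by
    rintro ⟨u, v⟩ huv
    by_cases hv : v = 0
    · subst hv
      simpa [a] using hb u (mt mem_setX.1 huv)
    · simp [a, hv]
  have hrow : ∀ α, rowPoly S a α = C (b α) := by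
    intro α
    ext β
    rw [coeff_rowPoly ha, coeff_C]
  have := h.eq_zero ha ?_
  · funext u
    simpa [a] using congrFun this (u, 0)
  · rintro ⟨x, y⟩ hz ⟨i, j⟩ hij
    rcases Nat.eq_zero_or_pos j with rfl | hj
    · rw [derivAt_zero_right hS.fst_mem_setX]
      simp only [hrow, eval_C]
      exact h0 x (Finset.mem_product.1 hz).1 i (mem_setX.2 hij)
    · refine Finset.sum_eq_zero fun uv _ => ?_
      by_cases hv : uv.2 = 0
      · simp [hv, Nat.descFactorial_eq_zero_iff_lt.2 hj]
      · simp [a, hv]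

lemma card_mul_le_card_filter {X Y : Finset ℝ} {A S : Finset (ℕ × ℕ)}
    (hS : IsLower S) (h : Regular (X ×ˢ Y) A S) :
    X.card * Y.card * (setX A).card ≤ (S.filter fun uv => uv.2 < Y.card).card := by
  rw [← Finset.card_product, ← Finset.card_product]
  refine card_le_of_solvable
    (M := fun k uv => (uv.1.descFactorial k.2 : ℝ) * (uv.2.descFactorial 0 : ℝ) *
      k.1.1 ^ (uv.1 - k.2) * k.1.2 ^ (uv.2 - 0)) fun c => ?_
  obtain ⟨a, ⟨ha, hac⟩, -⟩ := h fun ij z => c (z, ij.1)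
  set ω : ℝ[X] := ∏ y ∈ Y, (Polynomial.X - C y)
  have hω : ω.Monic := monic_prod_of_monic _ _ fun y _ => monic_X_sub_C y
  have hωdeg : ω.natDegree = Y.card := by simp [ω, natDegree_prod_of_monic, monic_X_sub_C]
  set a' : ℕ × ℕ → ℝ := fun uv => (rowPoly S a uv.1 %ₘ ω).coeff uv.2
  have ha' : ∀ uv, uv ∉ (S.filter fun uv => uv.2 < Y.card) → a' uv = 0 := by
    rintro ⟨u, v⟩ huv
    simp only [a']
    rcases lt_or_ge v Y.card with hv | hv
    · have hS' : (u, v) ∉ S := fun hmem => huv (Finset.mem_filter.2 ⟨hmem, hv⟩)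
      refine coeff_eq_zero_of_degree_lt (lt_of_le_of_lt (degree_modByMonic_le_left) ?_)
      rw [degree_lt_iff_coeff_zero]
      intro m hm
      rw [coeff_rowPoly ha]
      exact ha _ fun hmem => hS' (hS u m hmem _ _ le_rfl (by exact_mod_cast hm))
    · refine coeff_eq_zero_of_degree_lt (lt_of_lt_of_le (degree_modByMonic_lt _ hω) ?_)
      rw [degree_eq_natDegree hω.ne_zero, hωdeg]
      exact_mod_cast hv
  have hrow : ∀ α, rowPoly (S.filter fun uv => uv.2 < Y.card) a' α = rowPoly S a α %ₘ ω := by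
    intro α
    ext β
    rw [coeff_rowPoly ha']
  refine ⟨a', ?_⟩
  rintro ⟨⟨x, y⟩, i⟩ hk
  obtain ⟨hz, hi⟩ := Finset.mem_product.1 hk
  have hy : ω.eval y = 0 := by
    rw [eval_prod]
    exact Finset.prod_eq_zero (Finset.mem_product.1 hz).2 (by simp)
  have := hac (x, y) hz (i, 0) (mem_setX.1 hi)
  rw [derivAt_zero_right hS.fst_mem_setX] at this
  rw [← this, ← derivAt_eq_sum, derivAt_zero_right
    (U := setX S) fun uv huv => hS.fst_mem_setX uv (Finset.mem_filter.1 huv).1]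
  congr 1
  funext α
  rw [hrow]
  rw [modByMonic_eq_sub_mul_div, eval_sub, eval_mul, hy, zero_mul, sub_zero]

lemma row_eq_zero {X Y : Finset ℝ} {A S : Finset (ℕ × ℕ)} (hS : IsLower S)
    (h : Regular1 X (setX A) (setX S)) {a : ℕ × ℕ → ℝ} (ha : ∀ uv, uv ∉ S → a uv = 0)
    (h0 : ∀ z ∈ X ×ˢ Y, ∀ ij ∈ A, derivAt S a ij.1 ij.2 z.1 z.2 = 0) {α : ℕ}
    (hα : ∀ β, a (α, β) ≠ 0 → β < Y.card) (β : ℕ) : a (α, β) = 0 := by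
  have hroot : ∀ y ∈ Y, (rowPoly S a α).eval y = 0 := by
    intro y hy
    refine congrFun (h.eq_zero (a := fun α => (rowPoly S a α).eval y) ?_ ?_) α
    · intro u hu
      have : rowPoly S a u = 0 := by
        ext v
        rw [coeff_rowPoly ha]
        exact ha _ fun hmem => hu (hS.fst_mem_setX _ hmem)
      simp [this]
    · intro x hx i hi
      rw [← derivAt_zero_right hS.fst_mem_setX]
      exact h0 (x, y) (Finset.mk_mem_product hx hy) (i, 0) (mem_setX.1 hi)
  have : rowPoly S a α = 0 := by
    refine eq_zero_of_degree_lt_of_eval_finset_eq_zero Y ?_ hroot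
    rw [degree_lt_iff_coeff_zero]
    intro m hm
    rw [coeff_rowPoly ha]
    by_contra hne
    exact absurd (hα m hne) (not_lt.2 (by exact_mod_cast hm))
  rw [← coeff_rowPoly ha, this, coeff_zero]

end Rows

section Combinatorics

lemma IsRect.eq_product {p q : ℕ} {Z : Finset (ℝ × ℝ)} (h : IsRect p q Z) :
    Z = nodesX Z ×ˢ nodesY Z ∧ (nodesX Z).card = p + 1 ∧ (nodesY Z).card = q + 1 := by
  obtain ⟨x, y, hx, hy, rfl⟩ := h
  have hprod : (Finset.univ : Finset (Fin (p + 1) × Fin (q + 1))).image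
      (fun ij => (x ij.1, y ij.2)) = Finset.univ.image x ×ˢ Finset.univ.image y := by
    ext ⟨u, v⟩
    simp only [Finset.mem_image, Finset.mem_univ, true_and, Finset.mem_product, Prod.exists,
      Prod.mk.injEq]
    exact ⟨fun ⟨i, j, hi, hj⟩ => ⟨⟨i, hi⟩, j, hj⟩, fun ⟨⟨i, hi⟩, j, hj⟩ => ⟨i, j, hi, hj⟩⟩
  rw [hprod]
  have hX : nodesX (Finset.univ.image x ×ˢ Finset.univ.image y) = Finset.univ.image x :=
    Finset.product_image_fst (by simp)
  have hY : nodesY (Finset.univ.image x ×ˢ Finset.univ.image y) = Finset.univ.image y :=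
    Finset.product_image_snd (by simp)
  rw [hX, hY]
  exact ⟨rfl, by simp [Finset.card_image_of_injective _ hx],
    by simp [Finset.card_image_of_injective _ hy]⟩

lemma Nat.div_lt_succ_iff_lt_mul {m a s : ℕ} : a / (m + 1) < s ↔ a < (m + 1) * s := by
  rw [Nat.div_lt_iff_lt_mul (Nat.succ_pos m), mul_comm]

lemma mem_blowup {p q : ℕ} {R : Finset (ℕ × ℕ)} {α β : ℕ} :
    (α, β) ∈ blowup p q R ↔ (α / (p + 1), β / (q + 1)) ∈ R := by
  simp only [blowup, Finset.mem_image, Finset.mem_product, Finset.mem_range, Prod.exists,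
    Prod.mk.injEq]
  constructor
  · rintro ⟨u, v, i, j, ⟨hR, hi, hj⟩, rfl, rfl⟩
    rwa [Nat.mul_add_div (Nat.succ_pos p), Nat.mul_add_div (Nat.succ_pos q),
      Nat.div_eq_of_lt hi, Nat.div_eq_of_lt hj]
  · intro h
    exact ⟨_, _, α % (p + 1), β % (q + 1),
      ⟨h, Nat.mod_lt _ (Nat.succ_pos p), Nat.mod_lt _ (Nat.succ_pos q)⟩,
      Nat.div_add_mod _ _, Nat.div_add_mod _ _⟩

lemma blowup_hook (p q sx sy : ℕ) :
    blowup p q (rect sx 0 ∪ rect 0 sy) =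
      Finset.range ((p + 1) * (sx + 1)) ×ˢ Finset.range (q + 1) ∪
        Finset.range (p + 1) ×ˢ Finset.range ((q + 1) * (sy + 1)) := by
  ext ⟨α, β⟩
  simp only [mem_blowup, rect, Finset.mem_union, Finset.mem_product, Finset.mem_range,
    Nat.div_lt_succ_iff_lt_mul, zero_add, mul_one]

lemma IsLower.setX_eq_range {S : Finset (ℕ × ℕ)} (hS : IsLower S) :
    setX S = Finset.range (setX S).card := by
  refine (Finset.eq_of_subset_of_card_le (fun u hu => ?_) (by simp))
  rw [Finset.mem_range, Nat.lt_iff_add_one_le, ← Finset.card_range (u + 1)]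
  refine Finset.card_le_card fun i hi => ?_
  rw [mem_setX] at hu ⊢
  exact hS u 0 hu i 0 (Nat.lt_succ_iff.1 (Finset.mem_range.1 hi)) le_rfl

lemma card_setX (A : Finset (ℕ × ℕ)) : (setX A).card = (A.filter fun ij => ij.2 = 0).card := by
  refine Finset.card_image_of_injOn ?_
  rintro ⟨i, j⟩ h ⟨i', j'⟩ h' hii'
  simp_all

lemma card_setY (A : Finset (ℕ × ℕ)) : (setY A).card = (A.filter fun ij => ij.1 = 0).card := by
  refine Finset.card_image_of_injOn ?_
  rintro ⟨i, j⟩ h ⟨i', j'⟩ h' hii'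
  simp_all

lemma card_add_one_of_no_mixed {A : Finset (ℕ × ℕ)} (hmix : ∀ ij ∈ A, ij.1 = 0 ∨ ij.2 = 0)
    (h0 : (0, 0) ∈ A) : A.card + 1 = (setX A).card + (setY A).card := by
  rw [card_setX, card_setY, ← Finset.card_union_add_card_inter]
  congr 1
  · congr 1
    ext ij
    have := hmix ij
    simp only [Finset.mem_union, Finset.mem_filter]
    tauto
  · symm
    rw [Finset.card_eq_one]
    refine ⟨(0, 0), ?_⟩
    ext ⟨i, j⟩
    simp only [Finset.mem_inter, Finset.mem_filter, Finset.mem_singleton, Prod.mk.injEq]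
    constructor
    · tauto
    · rintro ⟨rfl, rfl⟩
      tauto

lemma Regular.zero_mem {Z : Finset (ℝ × ℝ)} {A S : Finset (ℕ × ℕ)} (h : Regular Z A S)
    (h0 : (0, 0) ∈ S) : (0, 0) ∈ A := by
  by_contra hA
  have := h.eq_zero (a := Pi.single (0, 0) 1)
    (fun uv huv => Pi.single_eq_of_ne (fun he => huv (by rwa [he])) _) ?_
  · simpa using congrFun this (0, 0)
  · rintro z - ⟨i, j⟩ hij
    refine Finset.sum_eq_zero fun uv _ => ?_
    by_cases huv : uv = (0, 0)
    · subst huv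
      rcases Nat.eq_zero_or_pos i with rfl | hi
      · rcases Nat.eq_zero_or_pos j with rfl | hj
        · exact absurd hij hA
        · simp [Nat.descFactorial_eq_zero_iff_lt.2 hj]
      · simp [Nat.descFactorial_eq_zero_iff_lt.2 hi]
    · simp [Pi.single_eq_of_ne huv]

/-- If the first `n` rows of a lower set carry at least `n * m` points and the bottom row
has at most `m` points, then they fill the rectangle `m × n`. -/
lemma IsLower.filter_snd_lt_eq {S : Finset (ℕ × ℕ)} (hS : IsLower S) {m n : ℕ} (hn : 0 < n)
    (hle : (setX S).card ≤ m) (hge : m * n ≤ (S.filter fun uv => uv.2 < n).card) :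
    (setX S).card = m ∧
      (S.filter fun uv => uv.2 < n) = Finset.range m ×ˢ Finset.range n := by
  have hsub : (S.filter fun uv => uv.2 < n) ⊆ setX S ×ˢ Finset.range n := by
    intro uv huv
    obtain ⟨h1, h2⟩ := Finset.mem_filter.1 huv
    exact Finset.mem_product.2 ⟨hS.fst_mem_setX _ h1, Finset.mem_range.2 h2⟩
  have hcard := Finset.card_le_card hsub
  rw [Finset.card_product, Finset.card_range] at hcard
  have hm : (setX S).card = m :=
    le_antisymm hle (Nat.le_of_mul_le_mul_right (hge.trans hcard) hn)
  refine ⟨hm, ?_⟩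
  rw [← hm, ← hS.setX_eq_range]
  refine Finset.eq_of_subset_of_card_le hsub ?_
  rw [Finset.card_product, Finset.card_range, hm]
  exact hge

end Combinatorics

/-- if `A` contains no mixed derivative, then `(Z,A,S)` with
`(p,q)`-rectangular nodes is regular iff both induced univariate schemes are
regular and `S = T^{p,q}` with `T = R(|A_x|-1,0) ∪ R(0,|A_y|-1)`. -/
theorem no_mixed_derivatives (p q sx sy : ℕ) (Z : Finset (ℝ × ℝ)) (A S : Finset (ℕ × ℕ))
    (hZ : IsRect p q Z) (hS : IsLower S) (hnorm : S.card = Z.card * A.card)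
    (hmix : ∀ ij ∈ A, ij.1 = 0 ∨ ij.2 = 0)
    (hsx : (setX A).card = sx + 1) (hsy : (setY A).card = sy + 1) :
    Regular Z A S ↔
      (Regular1 (nodesX Z) (setX A) (setX S) ∧
       Regular1 (nodesY Z) (setY A) (setY S) ∧
       S = blowup p q (rect sx 0 ∪ rect 0 sy)) := by
  obtain ⟨hprod, hXc, hYc⟩ := hZ.eq_product
  set X := nodesX Z
  set Y := nodesY Z
  have hZc : Z.card = (p + 1) * (q + 1) := by rw [hprod, Finset.card_product, hXc, hYc]
  have hS' := hS.image_swap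
  have hprod' : Z.image Prod.swap = Y ×ˢ X := by
    rw [hprod, Finset.image_swap_product]
  constructor
  · intro hreg
    have hS0 : (0, 0) ∈ S := by
      have hA : 0 < A.card := by
        have := Finset.card_filter_le A fun ij => ij.2 = 0
        rw [← card_setX] at this
        omega
      obtain ⟨⟨u, v⟩, huv⟩ := Finset.card_pos.1 (show 0 < S.card by
        rw [hnorm, hZc]
        exact Nat.mul_pos (Nat.mul_pos p.succ_pos q.succ_pos) hA)
      exact hS u v huv 0 0 (Nat.zero_le _) (Nat.zero_le _)
    have hAc := card_add_one_of_no_mixed hmix (hreg.zero_mem hS0)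
    have hreg' := hreg.image_swap
    rw [hprod'] at hreg'
    rw [hprod] at hreg
    have kerX := trivial_kernel_setX hS hreg
    have kerY := trivial_kernel_setX hS' hreg'
    have leX := card_le_of_trivial_kernel1 kerX
    have leY := card_le_of_trivial_kernel1 kerY
    have geX := card_mul_le_card_filter hS hreg
    have geY := card_mul_le_card_filter hS' hreg'
    simp only [setX_image_swap] at kerY leY geY
    rw [hXc, hsx] at leX
    rw [hYc, hsy] at leY
    rw [hXc, hYc, hsx] at geX
    rw [hXc, hYc, hsy] at geY
    obtain ⟨cX, eqX⟩ := hS.filter_snd_lt_eq (n := q + 1) q.succ_pos leX (by linarith)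
    obtain ⟨cY, eqY⟩ := hS'.filter_snd_lt_eq (m := (q + 1) * (sy + 1)) (n := p + 1)
      p.succ_pos (by rwa [setX_image_swap]) (by linarith)
    rw [setX_image_swap] at cY
    refine ⟨regular1_of_trivial_kernel (by rw [cX, hXc, hsx]) kerX,
      regular1_of_trivial_kernel (by rw [cY, hYc, hsy]) kerY, ?_⟩
    rw [blowup_hook]
    symm
    refine Finset.eq_of_subset_of_card_le (Finset.union_subset ?_ ?_) ?_
    · rw [← eqX]
      exact Finset.filter_subset _ _
    · rintro ⟨u, v⟩ huv
      have : (v, u) ∈ (S.image Prod.swap).filter fun uv => uv.2 < p + 1 := by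
        rw [eqY]
        simpa [and_comm] using huv
      simpa [mem_image_swap] using (Finset.mem_filter.1 this).1
    · have hcap : ((Finset.range ((p + 1) * (sx + 1)) ×ˢ Finset.range (q + 1)) ∩
          (Finset.range (p + 1) ×ˢ Finset.range ((q + 1) * (sy + 1)))).card
            ≤ (p + 1) * (q + 1) := by
        calc _ ≤ (Finset.range (p + 1) ×ˢ Finset.range (q + 1)).card := by
              refine Finset.card_le_card fun uv huv => ?_
              simp only [Finset.mem_inter, Finset.mem_product] at huv ⊢
              exact ⟨huv.2.1, huv.1.2⟩
          _ = _ := by simp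
      have hsum := Finset.card_union_add_card_inter
        (Finset.range ((p + 1) * (sx + 1)) ×ˢ Finset.range (q + 1))
        (Finset.range (p + 1) ×ˢ Finset.range ((q + 1) * (sy + 1)))
      simp only [Finset.card_product, Finset.card_range] at hsum
      have hA : A.card = sx + sy + 1 := by omega
      rw [hnorm, hZc, hA]
      nlinarith
  · rintro ⟨hX1, hY1, hshape⟩
    rw [blowup_hook] at hshape
    refine regular_of_trivial_kernel hnorm fun a ha h0 => ?_
    have hcol : ∀ u v, q + 1 ≤ v → a (u, v) = 0 := by
      intro u v hv
      rw [← setX_image_swap, ← setX_image_swap] at hY1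
      refine row_eq_zero (A := A.image Prod.swap) (Y := X) (a := a ∘ Prod.swap) (α := v) hS' hY1
        (fun uv huv => ha _ (mt mem_image_swap.2 huv)) ?_ ?_ u
      · intro z hz ij hij
        rw [derivAt_image_swap, Function.comp_assoc, Prod.swap_swap_eq, Function.comp_id]
        rw [← hprod'] at hz
        exact h0 z.swap (mem_image_swap.1 hz) ij.swap (mem_image_swap.1 hij)
      · intro β hβ
        have hmem : (β, v) ∈ S := by
          by_contra hne
          exact hβ (ha _ hne)
        rw [hshape] at hmem
        simp only [Finset.mem_union, Finset.mem_product, Finset.mem_range] at hmem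
        omega
    rw [hprod] at h0
    funext ⟨u, v⟩
    refine row_eq_zero hS hX1 ha h0 (fun β hβ => ?_) v
    by_contra hlt
    exact hβ (hcol u β (by omega))
end

section
/- Let p, q be nonnegative integers and set n = (p+1)(q+1). For every lower set L ⊂ ℤ≥0² one has n · n_{p,q}(L) ≥ |L|. -/
open Finset

/-- for every lower set `L`, `n·n_{p,q}(L) ≥ |L|` where
`n = (p+1)(q+1)`. -/
theorem npq_lower_bound (p q : ℕ) (L : Finset (ℕ × ℕ)) (hL : IsLower L) :
    L.card ≤ (p + 1) * (q + 1) * npq p q L := by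
  refine card_le_mul_card_image_of_maps_to
    (f := fun ab => ((p + 1) * (ab.1 / (p + 1)), (q + 1) * (ab.2 / (q + 1)))) ?_ _ ?_
  · rintro ⟨a, b⟩ hab
    exact mem_filter.2 ⟨hL a b hab _ _ (Nat.mul_div_le _ _) (Nat.mul_div_le _ _),
      dvd_mul_right _ _, dvd_mul_right _ _⟩
  · intro c _
    suffices h : _ ≤ #(range (p + 1) ×ˢ range (q + 1)) by simpa using h
    refine card_le_card_of_injOn (fun ab => (ab.1 % (p + 1), ab.2 % (q + 1))) ?_ ?_
    · intro ab _
      exact mem_product.2 ⟨mem_range.2 (Nat.mod_lt _ p.succ_pos),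
        mem_range.2 (Nat.mod_lt _ q.succ_pos)⟩
    · rintro ⟨a, b⟩ hab ⟨a', b'⟩ hab' h
      rw [mem_coe, mem_filter] at hab hab'
      simp only [Prod.mk.injEq] at h
      have h₁ := congrArg Prod.fst (hab.2.trans hab'.2.symm)
      have h₂ := congrArg Prod.snd (hab.2.trans hab'.2.symm)
      ext
      · rw [← Nat.div_add_mod a (p + 1), ← Nat.div_add_mod a' (p + 1), h.1]
        exact congrArg (· + _) h₁
      · rw [← Nat.div_add_mod b (q + 1), ← Nat.div_add_mod b' (q + 1), h.2]
        exact congrArg (· + _) h₂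
end

section
/- Let A ⊂ ℤ≥0² be a finite set and S a lower set with |S| = 4|A|. Then the following are equivalent: (i) there exists a (1,1)-rectangular set of nodes Z such that (Z,A,S) is regular; (ii) for every (1,1)-rectangular set of nodes Z, the scheme (Z,A,S) is regular. Moreover, in this case |L ∩ A| ≥ n_{1,1}(L) for every lower set L ⊆ S. -/
open Finset

/-- Coefficients of the polynomial `P(b + s x, d + t y)`, where `P` has coefficients `a`
supported on `S`. -/
noncomputable def affineCoeff (S : Finset (ℕ × ℕ)) (b s d t : ℝ) (a : ℕ × ℕ → ℝ)
    (mn : ℕ × ℕ) : ℝ :=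
  ∑ uv ∈ S, a uv * ((uv.1.choose mn.1 : ℝ) * s ^ mn.1 * b ^ (uv.1 - mn.1)) *
    ((uv.2.choose mn.2 : ℝ) * t ^ mn.2 * d ^ (uv.2 - mn.2))

theorem affineCoeff_eq_zero {S : Finset (ℕ × ℕ)} (hS : IsLower S) (b s d t : ℝ)
    (a : ℕ × ℕ → ℝ) {mn : ℕ × ℕ} (h : mn ∉ S) : affineCoeff S b s d t a mn = 0 := by
  refine Finset.sum_eq_zero fun uv huv => ?_
  rcases lt_or_ge uv.1 mn.1 with h1 | h1
  · simp [Nat.choose_eq_zero_of_lt h1]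
  rcases lt_or_ge uv.2 mn.2 with h2 | h2
  · simp [Nat.choose_eq_zero_of_lt h2]
  exact absurd (hS uv.1 uv.2 huv mn.1 mn.2 h1 h2) h

theorem sum_choose_mul_descFactorial (b s x : ℝ) (u i : ℕ) :
    ∑ m ∈ range (u + 1), ((u.choose m : ℝ) * s ^ m * b ^ (u - m)) *
      ((m.descFactorial i : ℝ) * x ^ (m - i)) =
    s ^ i * ((u.descFactorial i : ℝ) * (b + s * x) ^ (u - i)) := by
  rcases lt_or_ge u i with h | h
  · rw [Nat.descFactorial_of_lt h, Finset.sum_eq_zero]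
    · simp
    · intro m hm
      rw [Nat.descFactorial_of_lt (by rw [mem_range] at hm; omega)]
      simp
  · obtain ⟨k, rfl⟩ := Nat.exists_eq_add_of_le h
    rw [show i + k + 1 = i + (k + 1) by ring, Finset.sum_range_add, Finset.sum_eq_zero, zero_add,
      Nat.add_sub_cancel_left, add_comm b, add_pow, Finset.mul_sum, Finset.mul_sum]
    · refine Finset.sum_congr rfl fun m hm => ?_
      have hm' : m ≤ k := by rw [mem_range] at hm; omega
      have key : (i + k).choose (i + m) * (i + m).descFactorial i =
          (i + k).descFactorial i * k.choose m := by
        have := Nat.choose_mul (n := i + k) (k := i + m) (s := i) (by omega)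
        rw [Nat.descFactorial_eq_factorial_mul_choose, Nat.descFactorial_eq_factorial_mul_choose]
        simp only [Nat.add_sub_cancel_left] at this
        linear_combination i.factorial * this
      have key' : ((i + k).choose (i + m) : ℝ) * ((i + m).descFactorial i : ℝ) =
          ((i + k).descFactorial i : ℝ) * (k.choose m : ℝ) := by exact_mod_cast key
      rw [Nat.add_sub_cancel_left, show i + k - (i + m) = k - m by omega, pow_add, mul_pow]
      linear_combination s ^ i * s ^ m * b ^ (k - m) * x ^ m * key'
    · intro m hm
      rw [Nat.descFactorial_of_lt (mem_range.mp hm)]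
      simp

theorem derivAt_affineCoeff {S : Finset (ℕ × ℕ)} (hS : IsLower S) (b s d t : ℝ)
    (a : ℕ × ℕ → ℝ) (i j : ℕ) (x y : ℝ) :
    derivAt S (affineCoeff S b s d t a) i j x y =
      s ^ i * t ^ j * derivAt S a i j (b + s * x) (d + t * y) := by
  simp only [derivAt, affineCoeff, Finset.sum_mul, Finset.mul_sum]
  rw [Finset.sum_comm]
  refine Finset.sum_congr rfl fun uv huv => ?_
  have hsub : range (uv.1 + 1) ×ˢ range (uv.2 + 1) ⊆ S := by
    intro mn hmn
    simp only [mem_product, mem_range] at hmn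
    exact hS uv.1 uv.2 huv mn.1 mn.2 (by omega) (by omega)
  rw [← Finset.sum_subset hsub]
  · have hx := sum_choose_mul_descFactorial b s x uv.1 i
    have hy := sum_choose_mul_descFactorial d t y uv.2 j
    calc _ = a uv * ((∑ m ∈ range (uv.1 + 1), ((uv.1.choose m : ℝ) * s ^ m * b ^ (uv.1 - m)) *
          ((m.descFactorial i : ℝ) * x ^ (m - i))) *
          ∑ n ∈ range (uv.2 + 1), ((uv.2.choose n : ℝ) * t ^ n * d ^ (uv.2 - n)) *
          ((n.descFactorial j : ℝ) * y ^ (n - j))) := by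
          rw [Finset.sum_mul_sum, ← Finset.sum_product', Finset.mul_sum]
          exact Finset.sum_congr rfl fun mn _ => by ring
      _ = _ := by rw [hx, hy]; ring
  · intro mn _ hmn
    simp only [mem_product, mem_range, not_and_or, not_lt] at hmn
    rcases hmn with h | h
    · simp [Nat.choose_eq_zero_of_lt (show uv.1 < mn.1 by omega)]
    · simp [Nat.choose_eq_zero_of_lt (show uv.2 < mn.2 by omega)]

theorem derivAt_zero_zero {S : Finset (ℕ × ℕ)} (a : ℕ × ℕ → ℝ) {ij : ℕ × ℕ} (h : ij ∈ S) :
    derivAt S a ij.1 ij.2 0 0 = a ij * ij.1.factorial * ij.2.factorial := by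
  rw [derivAt, Finset.sum_eq_single_of_mem ij h]
  · simp [Nat.descFactorial_self]
  · intro uv _ hne
    rcases lt_trichotomy uv.1 ij.1 with h1 | h1 | h1
    · simp [Nat.descFactorial_of_lt h1]
    · rcases lt_trichotomy uv.2 ij.2 with h2 | h2 | h2
      · simp [Nat.descFactorial_of_lt h2]
      · exact absurd (Prod.ext h1 h2) hne
      · simp [Nat.sub_ne_zero_of_lt h2]
    · simp [Nat.sub_ne_zero_of_lt h1]

/-- Regularity is preserved by axis-parallel affine changes of the nodes. -/
theorem Regular.image_affine {Z : Finset (ℝ × ℝ)} {A S : Finset (ℕ × ℕ)} (hS : IsLower S)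
    (h : Regular Z A S) (b d : ℝ) {s t : ℝ} (hs : s ≠ 0) (ht : t ≠ 0) :
    Regular (Z.image fun z => (b + s * z.1, d + t * z.2)) A S := by
  intro c
  obtain ⟨a, ⟨-, ha⟩, huniq⟩ := h fun ij z => s ^ ij.1 * t ^ ij.2 * c ij (b + s * z.1, d + t * z.2)
  refine ⟨affineCoeff S (-b / s) s⁻¹ (-d / t) t⁻¹ a,
    ⟨fun uv huv => affineCoeff_eq_zero hS _ _ _ _ _ huv, ?_⟩, ?_⟩
  · intro z' hz' ij hij
    obtain ⟨z, hz, rfl⟩ := Finset.mem_image.mp hz'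
    rw [derivAt_affineCoeff hS, show -b / s + s⁻¹ * (b + s * z.1) = z.1 by field_simp; ring,
      show -d / t + t⁻¹ * (d + t * z.2) = z.2 by field_simp; ring, ha z hz ij hij, inv_pow, inv_pow]
    field_simp
  · have hsol : ∀ e : ℕ × ℕ → ℝ, (∀ z ∈ Z.image fun z => (b + s * z.1, d + t * z.2), ∀ ij ∈ A,
        derivAt S e ij.1 ij.2 z.1 z.2 = c ij z) → affineCoeff S b s d t e = a := by
      intro e he
      refine huniq _ ⟨fun uv huv => affineCoeff_eq_zero hS _ _ _ _ _ huv, fun z hz ij hij => ?_⟩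
      rw [derivAt_affineCoeff hS, he _ (Finset.mem_image_of_mem _ hz) ij hij]
    intro e ⟨he0, he⟩
    funext ij
    by_cases hij : ij ∈ S
    swap
    · rw [he0 ij hij, affineCoeff_eq_zero hS _ _ _ _ _ hij]
    have h1 := derivAt_affineCoeff hS b s d t e ij.1 ij.2 (-b / s) (-d / t)
    rw [hsol e he, show b + s * (-b / s) = 0 by field_simp; ring,
      show d + t * (-d / t) = 0 by field_simp; ring, derivAt_zero_zero e hij] at h1
    have h2 := derivAt_affineCoeff hS (-b / s) s⁻¹ (-d / t) t⁻¹ a ij.1 ij.2 0 0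
    rw [derivAt_zero_zero _ hij, mul_zero, mul_zero, add_zero, add_zero, h1, inv_pow, inv_pow] at h2
    have hf1 : (ij.1.factorial : ℝ) ≠ 0 := by positivity
    have hf2 : (ij.2.factorial : ℝ) ≠ 0 := by positivity
    refine (mul_right_cancel₀ hf1 (mul_right_cancel₀ hf2 (h2.trans ?_))).symm
    field_simp

theorem IsRect.exists_affine {Z Z' : Finset (ℝ × ℝ)} (hZ : IsRect 1 1 Z) (hZ' : IsRect 1 1 Z') :
    ∃ b s d t : ℝ, s ≠ 0 ∧ t ≠ 0 ∧ Z' = Z.image fun z => (b + s * z.1, d + t * z.2) := by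
  have line : ∀ x x' : Fin 2 → ℝ, Function.Injective x → Function.Injective x' →
      ∃ b s : ℝ, s ≠ 0 ∧ ∀ i, x' i = b + s * x i := by
    intro x x' hx hx'
    have h : x 1 - x 0 ≠ 0 := sub_ne_zero.mpr (hx.ne (by decide))
    have h' : x' 1 - x' 0 ≠ 0 := sub_ne_zero.mpr (hx'.ne (by decide))
    refine ⟨x' 0 - (x' 1 - x' 0) / (x 1 - x 0) * x 0, (x' 1 - x' 0) / (x 1 - x 0),
      div_ne_zero h' h, fun i => ?_⟩
    fin_cases i
    · simp
    · simp only [Fin.mk_one]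
      field_simp
      ring
  obtain ⟨x, y, hx, hy, rfl⟩ := hZ
  obtain ⟨x', y', hx', hy', rfl⟩ := hZ'
  obtain ⟨b, s, hs, hxx⟩ := line x x' hx hx'
  obtain ⟨d, t, ht, hyy⟩ := line y y' hy hy'
  refine ⟨b, s, d, t, hs, ht, ?_⟩
  rw [Finset.image_image]
  exact Finset.image_congr fun ij _ => Prod.ext (hxx ij.1) (hyy ij.2)

theorem Regular.of_isRect {Z Z' : Finset (ℝ × ℝ)} {A S : Finset (ℕ × ℕ)} (hS : IsLower S)
    (h : Regular Z A S) (hZ : IsRect 1 1 Z) (hZ' : IsRect 1 1 Z') : Regular Z' A S := by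
  obtain ⟨b, s, d, t, hs, ht, rfl⟩ := hZ.exists_affine hZ'
  exact h.image_affine hS b d hs ht

theorem pow_sub_of_even {e : ℝ} (he : e = 1 ∨ e = -1) {u i : ℕ} (hu : 2 ∣ u) (hi : i ≤ u) :
    e ^ (u - i) = e ^ i := by
  obtain ⟨k, rfl⟩ := Nat.exists_eq_add_of_le hi
  rcases he with rfl | rfl
  · simp
  · rw [Nat.add_sub_cancel_left]
    rcases Nat.even_or_odd i with h | h
    · have : Even k := by rw [Nat.even_iff] at h ⊢; omega
      rw [h.neg_one_pow, this.neg_one_pow]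
    · have : Odd k := by rw [Nat.odd_iff] at h ⊢; omega
      rw [h.neg_one_pow, this.neg_one_pow]

/-- A derivative of a polynomial even in both variables is, up to sign, symmetric on `{±1}²`. -/
theorem derivAt_sign_of_even (S : Finset (ℕ × ℕ)) {a : ℕ × ℕ → ℝ}
    (ha : ∀ uv, a uv ≠ 0 → 2 ∣ uv.1 ∧ 2 ∣ uv.2) (i j : ℕ) {x y : ℝ}
    (hx : x = 1 ∨ x = -1) (hy : y = 1 ∨ y = -1) :
    derivAt S a i j x y = x ^ i * y ^ j * derivAt S a i j 1 1 := by
  rw [derivAt, derivAt, Finset.mul_sum]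
  refine Finset.sum_congr rfl fun uv _ => ?_
  by_cases h0 : a uv = 0
  · simp [h0]
  rcases lt_or_ge uv.1 i with h1 | h1
  · simp [Nat.descFactorial_of_lt h1]
  rcases lt_or_ge uv.2 j with h2 | h2
  · simp [Nat.descFactorial_of_lt h2]
  rw [pow_sub_of_even hx (ha uv h0).1 h1, pow_sub_of_even hy (ha uv h0).2 h2]
  simp only [one_pow]
  ring

theorem derivAt_eq_zero_of_notMem (S : Finset (ℕ × ℕ)) {L : Finset (ℕ × ℕ)} (hL : IsLower L)
    {a : ℕ × ℕ → ℝ} (ha : ∀ uv, a uv ≠ 0 → uv ∈ L) {i j : ℕ} (h : (i, j) ∉ L) (x y : ℝ) :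
    derivAt S a i j x y = 0 := by
  refine Finset.sum_eq_zero fun uv _ => ?_
  by_cases h0 : a uv = 0
  · simp [h0]
  rcases lt_or_ge uv.1 i with h1 | h1
  · simp [Nat.descFactorial_of_lt h1]
  rcases lt_or_ge uv.2 j with h2 | h2
  · simp [Nat.descFactorial_of_lt h2]
  exact absurd (hL uv.1 uv.2 (ha uv h0) i j h1 h2) h

/-- The `(1,1)`-Pólya inequalities, for a scheme regular on `{±1}²`. -/
theorem Regular.npq_le_card {Z : Finset (ℝ × ℝ)} {A S L : Finset (ℕ × ℕ)} (h : Regular Z A S)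
    (hZ : ∀ z ∈ Z, (z.1 = 1 ∨ z.1 = -1) ∧ (z.2 = 1 ∨ z.2 = -1)) (hLS : L ⊆ S) (hL : IsLower L) :
    npq 1 1 L ≤ (L ∩ A).card := by
  classical
  let E := L.filter fun ab => (1 + 1) ∣ ab.1 ∧ (1 + 1) ∣ ab.2
  have hES : E ⊆ S := (Finset.filter_subset _ _).trans hLS
  let M : Matrix (L ∩ A : Finset (ℕ × ℕ)) E ℝ := fun ij uv =>
    (uv.1.1.descFactorial ij.1.1 : ℝ) * (uv.1.2.descFactorial ij.1.2 : ℝ)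
  have hinj : Function.Injective M.mulVecLin := by
    rw [← LinearMap.ker_eq_bot, LinearMap.ker_eq_bot']
    intro w hw
    let a : ℕ × ℕ → ℝ := fun uv => if huv : uv ∈ E then w ⟨uv, huv⟩ else 0
    have haE : ∀ uv, uv ∉ E → a uv = 0 := fun uv huv => dif_neg huv
    have haE' : ∀ uv, a uv ≠ 0 → uv ∈ E := fun uv => not_imp_comm.mp (haE uv)
    have hder : ∀ ij ∈ L ∩ A, derivAt S a ij.1 ij.2 1 1 = 0 := by
      intro ij hij
      have hM := congrFun hw ⟨ij, hij⟩
      rw [Matrix.mulVecLin_apply, Matrix.mulVec, dotProduct, Pi.zero_apply] at hM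
      rw [derivAt, ← Finset.sum_subset hES fun uv _ huv => by simp [haE uv huv],
        ← Finset.sum_coe_sort, ← hM]
      refine Finset.sum_congr rfl fun uv _ => ?_
      simp only [a, M, uv.2, dif_pos, one_pow, Subtype.coe_eta]
      ring
    have hzero : ∀ z ∈ Z, ∀ ij ∈ A, derivAt S a ij.1 ij.2 z.1 z.2 = 0 := by
      intro z hz ij hij
      by_cases hijL : ij ∈ L
      · rw [derivAt_sign_of_even S (fun uv huv => (Finset.mem_filter.mp (haE' uv huv)).2) _ _
          (hZ z hz).1 (hZ z hz).2, hder ij (Finset.mem_inter.mpr ⟨hijL, hij⟩), mul_zero]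
      · exact derivAt_eq_zero_of_notMem S hL
          (fun uv huv => (Finset.mem_filter.mp (haE' uv huv)).1) hijL _ _
    have ha0 : a = 0 := (h fun _ _ => 0).unique
      ⟨fun uv huv => haE uv fun hmem => huv (hES hmem), hzero⟩
      ⟨fun _ _ => rfl, fun z _ ij _ => by simp [derivAt]⟩
    funext uv
    have := congrFun ha0 uv.1
    simpa [a, uv.2] using this
  have hle := LinearMap.finrank_le_finrank_of_injective hinj
  rwa [Module.finrank_fintype_fun_eq_card, Module.finrank_fintype_fun_eq_card, Fintype.card_coe,
    Fintype.card_coe] at hle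

theorem injective_one_neg_one : Function.Injective (![1, -1] : Fin 2 → ℝ) := by
  intro i j h
  fin_cases i <;> fin_cases j <;> first | rfl | norm_num at h

/-- for `(1,1)`-rectangular sets of nodes, regularity for one
such `Z` is equivalent to regularity for all such `Z`, and in that case the
`(1,1)`-Polya inequalities hold. -/
theorem case_one_one (A S : Finset (ℕ × ℕ))
    (hS : IsLower S) (hcard : S.card = 4 * A.card) :
    ((∃ Z : Finset (ℝ × ℝ), IsRect 1 1 Z ∧ Regular Z A S) ↔
      (∀ Z : Finset (ℝ × ℝ), IsRect 1 1 Z → Regular Z A S)) ∧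
    ((∃ Z : Finset (ℝ × ℝ), IsRect 1 1 Z ∧ Regular Z A S) →
      ∀ L ⊆ S, IsLower L → npq 1 1 L ≤ (L ∩ A).card) := by
  let Z₀ : Finset (ℝ × ℝ) := (Finset.univ : Finset (Fin (1 + 1) × Fin (1 + 1))).image
    fun ij => ((![1, -1] : Fin 2 → ℝ) ij.1, (![1, -1] : Fin 2 → ℝ) ij.2)
  have hZ₀ : IsRect 1 1 Z₀ := ⟨_, _, injective_one_neg_one, injective_one_neg_one, rfl⟩
  refine ⟨⟨fun ⟨Z, hZ, h⟩ Z' hZ' => h.of_isRect hS hZ hZ', fun h => ⟨Z₀, hZ₀, h Z₀ hZ₀⟩⟩, ?_⟩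
  rintro ⟨Z, hZ, h⟩ L hLS hL
  refine (h.of_isRect hS hZ hZ₀).npq_le_card (fun z hz => ?_) hLS hL
  obtain ⟨⟨i, j⟩, -, rfl⟩ := Finset.mem_image.mp hz
  fin_cases i <;> fin_cases j <;> simp
end

section
/- Let p, q be nonnegative integers, let A ⊂ ℤ≥0² be a finite set and S a lower set with |S| = (p+1)(q+1)|A|. Suppose that for every (p,q)-rectangular set of complex nodes Z the scheme (Z,A,S) is regular (over ℂ). Then |L ∩ A| ≥ n_{p,q}(L) for every lower set L ⊆ S; in particular S = R^{p,q} for some lower set R. -/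
open Finset

/-- Value at `(x,y)` of `∂^{i+j}P/∂x^i∂y^j` for a complex polynomial with
coefficients `a` supported on `S`. -/
noncomputable def derivAtC (S : Finset (ℕ × ℕ)) (a : ℕ × ℕ → ℂ) (i j : ℕ) (x y : ℂ) : ℂ :=
  ∑ uv ∈ S, a uv * (uv.1.descFactorial i : ℂ) * (uv.2.descFactorial j : ℂ) *
      x ^ (uv.1 - i) * y ^ (uv.2 - j)

/-- Regularity over `ℂ` of the scheme `(Z,A,S)`. -/
def RegularC (Z : Finset (ℂ × ℂ)) (A S : Finset (ℕ × ℕ)) : Prop :=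
  ∀ c : ℕ × ℕ → ℂ × ℂ → ℂ, ∃! a : ℕ × ℕ → ℂ,
    (∀ uv, uv ∉ S → a uv = 0) ∧
    ∀ z ∈ Z, ∀ ij ∈ A, derivAtC S a ij.1 ij.2 z.1 z.2 = c ij z

/-- `(p,q)`-rectangular set of complex nodes. -/
def IsRectC (p q : ℕ) (Z : Finset (ℂ × ℂ)) : Prop :=
  ∃ x : Fin (p + 1) → ℂ, ∃ y : Fin (q + 1) → ℂ,
    Function.Injective x ∧ Function.Injective y ∧
    Z = (Finset.univ : Finset (Fin (p + 1) × Fin (q + 1))).image (fun ij => (x ij.1, y ij.2))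

/-- At the node `(ω ^ k, η ^ l)` built from roots of unity, the derivatives of a polynomial whose
exponents lie in one residue class are multiples of those at `(1, 1)`. -/
theorem derivAtC_rootsOfUnity {m n r s : ℕ} {ω η : ℂ} (hω : ω ^ m = 1) (hη : η ^ n = 1)
    {S : Finset (ℕ × ℕ)} {a : ℕ × ℕ → ℂ}
    (ha : ∀ uv ∈ S, a uv ≠ 0 → uv.1 % m = r ∧ uv.2 % n = s) (i j k l : ℕ) :
    (ω ^ k) ^ i * (η ^ l) ^ j * derivAtC S a i j (ω ^ k) (η ^ l) =
      (ω ^ k) ^ r * (η ^ l) ^ s * derivAtC S a i j 1 1 := by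
  have pow_mod {z : ℂ} {d t : ℕ} (hz : z ^ d = 1) (e u : ℕ) (hu : u % d = t) :
      (z ^ e) ^ u = (z ^ e) ^ t := by
    rw [← hu]
    exact pow_eq_pow_mod u (by rw [← pow_mul, mul_comm, pow_mul, hz, one_pow])
  unfold derivAtC
  rw [Finset.mul_sum, Finset.mul_sum]
  refine Finset.sum_congr rfl fun uv huv => ?_
  by_cases h0 : a uv = 0
  · simp [h0]
  by_cases hi : uv.1 < i
  · simp [Nat.descFactorial_of_lt hi]
  by_cases hj : uv.2 < j
  · simp [Nat.descFactorial_of_lt hj]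
  obtain ⟨hr, hs⟩ := ha uv huv h0
  rw [← pow_mod hω k _ hr, ← pow_mod hη l _ hs, ← pow_mul_pow_sub (ω ^ k) (not_lt.mp hi),
    ← pow_mul_pow_sub (η ^ l) (not_lt.mp hj)]
  simp only [one_pow]
  ring

/-- If a scheme is regular for all rectangular sets of nodes, then exponents in a single residue
class cannot outnumber the derivative orders which do not kill them all. -/
theorem card_le_card_of_residue_class {p q : ℕ} {A S : Finset (ℕ × ℕ)}
    (h : ∀ Z : Finset (ℂ × ℂ), IsRectC p q Z → RegularC Z A S)
    {T B : Finset (ℕ × ℕ)} (hT : T ⊆ S) {r s : ℕ}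
    (hres : ∀ uv ∈ T, uv.1 % (p + 1) = r ∧ uv.2 % (q + 1) = s)
    (hB : ∀ uv ∈ T, ∀ ij ∈ A, ij ∉ B → uv.1 < ij.1 ∨ uv.2 < ij.2) :
    T.card ≤ B.card := by
  obtain ⟨ω, hω⟩ : ∃ ω : ℂ, IsPrimitiveRoot ω (p + 1) :=
    ⟨_, Complex.isPrimitiveRoot_exp _ p.succ_ne_zero⟩
  obtain ⟨η, hη⟩ : ∃ η : ℂ, IsPrimitiveRoot η (q + 1) :=
    ⟨_, Complex.isPrimitiveRoot_exp _ q.succ_ne_zero⟩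
  have hreg := h _ ⟨fun k => ω ^ (k : ℕ), fun l => η ^ (l : ℕ),
    fun k l hkl => Fin.ext (hω.pow_inj k.2 l.2 hkl),
    fun k l hkl => Fin.ext (hη.pow_inj k.2 l.2 hkl), rfl⟩ 0
  let M : Matrix B T ℂ := Matrix.of fun ij uv =>
    (uv.1.1.descFactorial ij.1.1 : ℂ) * (uv.1.2.descFactorial ij.1.2 : ℂ)
  have hinj : Function.Injective M.mulVecLin := by
    rw [injective_iff_map_eq_zero]
    intro b hb
    let a : ℕ × ℕ → ℂ := fun uv => if huv : uv ∈ T then b ⟨uv, huv⟩ else 0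
    have haT : ∀ uv, uv ∉ T → a uv = 0 := fun uv huv => dif_neg huv
    have hone : ∀ ij ∈ A, derivAtC S a ij.1 ij.2 1 1 = 0 := by
      intro ij hij
      have hsum : derivAtC S a ij.1 ij.2 1 1 = ∑ uv : T,
          (uv.1.1.descFactorial ij.1 : ℂ) * (uv.1.2.descFactorial ij.2 : ℂ) * b uv := by
        unfold derivAtC
        rw [← Finset.sum_subset hT fun uv _ huv => by simp [haT uv huv], ← Finset.sum_coe_sort T]
        refine Finset.sum_congr rfl fun uv _ => ?_
        simp only [a, uv.2, dif_pos, one_pow]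
        ring
      rw [hsum]
      by_cases hijB : ij ∈ B
      · exact congrFun hb ⟨ij, hijB⟩
      · refine Finset.sum_eq_zero fun uv _ => ?_
        rcases hB uv uv.2 ij hij hijB with hlt | hlt <;> simp [Nat.descFactorial_of_lt hlt]
    have hzero : a = 0 := by
      refine hreg.unique ⟨fun uv huv => haT uv fun hu => huv (hT hu), ?_⟩
        ⟨fun _ _ => rfl, fun _ _ _ _ => by simp [derivAtC]⟩
      intro z hz ij hij
      obtain ⟨⟨k, l⟩, -, rfl⟩ := Finset.mem_image.mp hz
      have key := derivAtC_rootsOfUnity hω.pow_eq_one hη.pow_eq_one (S := S) (a := a)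
        (fun uv _ h0 => hres uv (by_contra fun hu => h0 (haT uv hu))) ij.1 ij.2 k l
      rw [hone ij hij, mul_zero] at key
      refine (mul_eq_zero.mp key).resolve_left (mul_ne_zero ?_ ?_)
      · exact pow_ne_zero _ (pow_ne_zero _ (hω.ne_zero p.succ_ne_zero))
      · exact pow_ne_zero _ (pow_ne_zero _ (hη.ne_zero q.succ_ne_zero))
    funext uv
    have := congrFun hzero uv
    simpa [a] using this
  simpa using LinearMap.finrank_le_finrank_of_injective hinj

/-- A lower set whose residue classes modulo `(p + 1, q + 1)` all have the same cardinality is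
a blow-up of a lower set. -/
theorem exists_eq_blowup_of_card_residue_class {p q N : ℕ} {S : Finset (ℕ × ℕ)} (hS : IsLower S)
    (hN : ∀ r ≤ p, ∀ s ≤ q,
      (S.filter fun uv => uv.1 % (p + 1) = r ∧ uv.2 % (q + 1) = s).card = N) :
    ∃ R : Finset (ℕ × ℕ), IsLower R ∧ S = blowup p q R := by
  have hshift : ∀ a b, ((p + 1) * a, (q + 1) * b) ∈ S →
      ((p + 1) * a + p, (q + 1) * b + q) ∈ S := by
    intro a b hab
    let f : ℕ × ℕ → ℕ × ℕ := fun uv => (uv.1 - p, uv.2 - q)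
    set T := S.filter fun uv => uv.1 % (p + 1) = p ∧ uv.2 % (q + 1) = q
    have hle : ∀ uv ∈ T, p ≤ uv.1 ∧ q ≤ uv.2 := by
      intro uv huv
      obtain ⟨-, h1, h2⟩ := Finset.mem_filter.mp huv
      exact ⟨h1 ▸ Nat.mod_le _ _, h2 ▸ Nat.mod_le _ _⟩
    have hf : Set.InjOn f T := by
      intro uv huv uv' huv' heq
      have h1 := hle uv huv
      have h2 := hle uv' huv'
      simp only [f, Prod.mk.injEq] at heq
      ext <;> omega
    have himage : T.image f = S.filter fun uv => uv.1 % (p + 1) = 0 ∧ uv.2 % (q + 1) = 0 := by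
      refine Finset.eq_of_subset_of_card_le ?_ ?_
      · intro z hz
        obtain ⟨uv, huv, rfl⟩ := Finset.mem_image.mp hz
        obtain ⟨hmem, h1, h2⟩ := Finset.mem_filter.mp huv
        have sub_mod {w d : ℕ} (hw : w % (d + 1) = d) : (w - d) % (d + 1) = 0 := by
          exact Nat.mod_eq_zero_of_dvd (by simpa only [hw] using Nat.dvd_sub_mod (n := d + 1) w)
        exact Finset.mem_filter.mpr ⟨hS uv.1 uv.2 hmem _ _ (Nat.sub_le _ _) (Nat.sub_le _ _),
          sub_mod h1, sub_mod h2⟩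
      · rw [Finset.card_image_of_injOn hf, hN 0 p.zero_le 0 q.zero_le, hN p le_rfl q le_rfl]
    have hmem : ((p + 1) * a, (q + 1) * b) ∈ T.image f := by
      rw [himage]
      simp [hab]
    obtain ⟨uv, huv, heq⟩ := Finset.mem_image.mp hmem
    have hpq := hle uv huv
    simp only [f, Prod.mk.injEq] at heq
    have huv' : ((p + 1) * a + p, (q + 1) * b + q) = uv := by
      ext <;> simp only <;> omega
    rw [huv']
    exact (Finset.mem_filter.mp huv).1
  have hfloor : ∀ u v, (u, v) ∈ S → ((p + 1) * (u / (p + 1)), (q + 1) * (v / (q + 1))) ∈ S :=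
    fun u v huv => hS u v huv _ _ (Nat.mul_div_le _ _) (Nat.mul_div_le _ _)
  refine ⟨S.image fun uv => (uv.1 / (p + 1), uv.2 / (q + 1)), ?_, ?_⟩
  · intro u v huv i j hi hj
    obtain ⟨⟨u', v'⟩, hmem, heq⟩ := Finset.mem_image.mp huv
    obtain ⟨rfl, rfl⟩ := Prod.mk.inj heq
    refine Finset.mem_image.mpr ⟨((p + 1) * i, (q + 1) * j), ?_, by simp⟩
    exact hS _ _ (hfloor u' v' hmem) _ _ (Nat.mul_le_mul_left _ hi) (Nat.mul_le_mul_left _ hj)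
  · ext ⟨u, v⟩
    simp only [blowup, Finset.mem_image, Finset.mem_product, Finset.mem_range]
    constructor
    · intro huv
      exact ⟨((u / (p + 1), v / (q + 1)), (u % (p + 1), v % (q + 1))),
        ⟨⟨(u, v), huv, rfl⟩, Nat.mod_lt _ p.succ_pos, Nat.mod_lt _ q.succ_pos⟩,
        by simp [Nat.div_add_mod]⟩
    · rintro ⟨⟨⟨a, b⟩, i, j⟩, ⟨⟨⟨u', v'⟩, hmem, heq⟩, hi, hj⟩, heq'⟩
      obtain ⟨rfl, rfl⟩ := Prod.mk.inj heq
      obtain ⟨rfl, rfl⟩ := Prod.mk.inj heq'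
      exact hS _ _ (hshift _ _ (hfloor u' v' hmem)) _ _
        (Nat.add_le_add_left (Nat.le_of_lt_succ hi) _)
        (Nat.add_le_add_left (Nat.le_of_lt_succ hj) _)

/-- regularity with respect to all `(p,q)`-rectangular sets of
complex nodes implies the `(p,q)`-Polya inequalities, and in particular `S` is
a blow-up of a lower set. -/
theorem complex_regular_polya (p q : ℕ) (A S : Finset (ℕ × ℕ))
    (hS : IsLower S) (hcard : S.card = (p + 1) * (q + 1) * A.card)
    (h : ∀ Z : Finset (ℂ × ℂ), IsRectC p q Z → RegularC Z A S) :
    (∀ L ⊆ S, IsLower L → npq p q L ≤ (L ∩ A).card) ∧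
    (∃ R : Finset (ℕ × ℕ), IsLower R ∧ S = blowup p q R) := by
  constructor
  · intro L hLS hL
    refine card_le_card_of_residue_class h (r := 0) (s := 0)
      ((Finset.filter_subset _ _).trans hLS) (fun uv huv => ?_) (fun uv huv ij hij hijB => ?_)
    · obtain ⟨-, h1, h2⟩ := Finset.mem_filter.mp huv
      exact ⟨Nat.mod_eq_zero_of_dvd h1, Nat.mod_eq_zero_of_dvd h2⟩
    · by_contra! hle
      exact hijB (Finset.mem_inter.mpr
        ⟨hL uv.1 uv.2 (Finset.mem_filter.mp huv).1 _ _ hle.1 hle.2, hij⟩)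
  · let I := Finset.range (p + 1) ×ˢ Finset.range (q + 1)
    let C : ℕ × ℕ → Finset (ℕ × ℕ) := fun rs =>
      S.filter fun uv => uv.1 % (p + 1) = rs.1 ∧ uv.2 % (q + 1) = rs.2
    have hle : ∀ rs ∈ I, (C rs).card ≤ A.card := fun rs _ =>
      card_le_card_of_residue_class h (Finset.filter_subset _ _)
        (fun uv huv => (Finset.mem_filter.mp huv).2) fun _ _ ij hij hij' => absurd hij hij'
    have hsum : ∑ rs ∈ I, (C rs).card = ∑ rs ∈ I, A.card := by
      have hfiber := Finset.card_eq_sum_card_fiberwise (s := S) (t := I)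
        (f := fun uv => (uv.1 % (p + 1), uv.2 % (q + 1))) fun uv _ =>
          Finset.mem_coe.mpr (Finset.mem_product.mpr
            ⟨Finset.mem_range.mpr (Nat.mod_lt _ p.succ_pos),
              Finset.mem_range.mpr (Nat.mod_lt _ q.succ_pos)⟩)
      simp only [Prod.ext_iff] at hfiber
      rw [← hfiber, hcard]
      simp [I]
    have heq := (Finset.sum_eq_sum_iff_of_le hle).mp hsum
    exact exists_eq_blowup_of_card_residue_class hS fun r hr s hs => heq (r, s)
      (by simp [I]; omega)
end

section
/- Let p, q be nonnegative integers, n = (p+1)(q+1), let S be a lower set and A ⊆ ℤ≥0² a finite set with |S| = n·|A|. Then the following are equivalent: (i) |L ∩ A| ≥ n_{p,q}(L) for every lower set L ⊆ S; (ii) A ⊆ S and there exists a shift of A in S which moves A onto S ∩ Z^{p,q}, where Z^{p,q} = {((p+1)i, (q+1)j) : i,j ∈ ℤ≥0}. -/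
open Finset

/-- One step of a shift of a finite set `B` inside `S`: one element of `B` is
moved one step to the right or upwards, to a position in `S` not occupied by
another element of `B`. -/
def MoveStep (S : Finset (ℕ × ℕ)) (B B' : Finset (ℕ × ℕ)) : Prop :=
  ∃ e ∈ B, ∃ e' : ℕ × ℕ, (e' = (e.1 + 1, e.2) ∨ e' = (e.1, e.2 + 1)) ∧
    e' ∈ S ∧ e' ∉ B ∧ B' = insert e' (B.erase e)

/-- Moving one element right or upwards does not increase the number of elements in a
lower set. -/
theorem MoveStep.card_inter_le {S B B' L : Finset (ℕ × ℕ)} (h : MoveStep S B B')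
    (hL : IsLower L) : (L ∩ B').card ≤ (L ∩ B).card := by
  obtain ⟨e, he, e', hee, -, he', rfl⟩ := h
  by_cases hm : e' ∈ L
  · have heL : e ∈ L := by
      rcases hee with rfl | rfl
      · exact hL _ _ hm _ _ (Nat.le_succ _) le_rfl
      · exact hL _ _ hm _ _ le_rfl (Nat.le_succ _)
    have hsub : L ∩ insert e' (B.erase e) ⊆ insert e' ((L ∩ B).erase e) := by
      intro x
      simp only [mem_inter, mem_insert, mem_erase]
      tauto
    refine (card_le_card hsub).trans ((card_insert_le _ _).trans ?_)
    rw [card_erase_add_one (mem_inter.2 ⟨heL, he⟩)]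
  · refine card_le_card fun x hx => ?_
    simp only [mem_inter, mem_insert, mem_erase] at hx ⊢
    rcases hx with ⟨hxL, rfl | ⟨-, hxB⟩⟩
    · exact absurd hxL hm
    · exact ⟨hxL, hxB⟩

/-- If `g` matches every `t ∈ T` with a position `g t ≤ t` and some `t` is not matched with
itself, then one move can be made keeping such a matching. -/
theorem exists_moveStep_of_matching {S T : Finset (ℕ × ℕ)} (hS : IsLower S) (hT : T ⊆ S)
    (k : ℕ) (g : T → ℕ × ℕ) (hg : Function.Injective g) (hle : ∀ t, g t ≤ t.1) (t : T)
    (ht : g t ≠ t.1) (hk : ∀ s ∈ S, s.1 + s.2 ≤ (g t).1 + (g t).2 + k) :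
    ∃ g' : T → ℕ × ℕ, Function.Injective g' ∧ (∀ t, g' t ≤ t.1) ∧
      MoveStep S (univ.image g) (univ.image g') := by
  induction k generalizing g t with
  | zero =>
    have h1 := hk _ (hT t.2)
    have h2 := Prod.le_def.1 (hle t)
    exact absurd (Prod.ext (by lia) (by lia)) ht
  | succ k ih =>
    obtain ⟨e', hee, het⟩ : ∃ e' : ℕ × ℕ,
        (e' = ((g t).1 + 1, (g t).2) ∨ e' = ((g t).1, (g t).2 + 1)) ∧ e' ≤ t.1 := by
      have h2 := Prod.le_def.1 (hle t)
      by_cases h : (g t).1 = t.1.1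
      · refine ⟨_, Or.inr rfl, Prod.le_def.2 ⟨h2.1, ?_⟩⟩
        have : (g t).2 ≠ t.1.2 := fun h' => ht (Prod.ext h h')
        show (g t).2 + 1 ≤ _
        lia
      · refine ⟨_, Or.inl rfl, Prod.le_def.2 ⟨?_, h2.2⟩⟩
        show (g t).1 + 1 ≤ _
        lia
    have hge : g t ≤ e' := by
      rcases hee with rfl | rfl <;> simp [Prod.le_def]
    have hne : g t ≠ e' := by
      rcases hee with rfl | rfl <;> simp [Prod.ext_iff]
    have hdeg : e'.1 + e'.2 = (g t).1 + (g t).2 + 1 := by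
      rcases hee with rfl | rfl <;> simp only <;> lia
    have heS : e' ∈ S := hS _ _ (hT t.2) _ _ (Prod.le_def.1 het).1 (Prod.le_def.1 het).2
    have hswap_inj : Function.Injective (Equiv.swap (g t) e' ∘ g) :=
      (Equiv.injective _).comp hg
    have hswap_le : ∀ s, (Equiv.swap (g t) e' ∘ g) s ≤ s.1 := by
      intro s
      by_cases h1 : g s = g t
      · rw [hg h1]
        simpa using het
      · by_cases h2 : g s = e'
        · simpa [h2] using hge.trans (h2 ▸ hle s)
        · simpa [Equiv.swap_apply_of_ne_of_ne h1 h2] using hle s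
    by_cases hmem : ∃ s, g s = e'
    · obtain ⟨s, hs⟩ := hmem
      by_cases het' : e' = t.1
      · refine ih g hg hle s (fun h => hne ?_) fun x hx => ?_
        · have : s = t := Subtype.ext (h.symm.trans (hs.trans het'))
          rw [← hs, this]
        · have := hk x hx
          rw [hs]
          lia
      · obtain ⟨g', hg', hle', hstep⟩ := ih _ hswap_inj hswap_le t (by simpa using het')
          (fun x hx => by
            have := hk x hx
            simp only [Function.comp_apply, Equiv.swap_apply_left]
            lia)
        refine ⟨g', hg', hle', ?_⟩
        convert hstep using 1
        have himg : ∀ x, (∃ a, g a = x) ↔ ∃ a, g a = Equiv.swap (g t) e' x := by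
          intro x
          by_cases h1 : x = g t
          · subst h1
            simp only [Equiv.swap_apply_left]
            exact iff_of_true ⟨t, rfl⟩ ⟨s, hs⟩
          · by_cases h2 : x = e'
            · subst h2
              simp only [Equiv.swap_apply_right]
              exact iff_of_true ⟨s, hs⟩ ⟨t, rfl⟩
            · rw [Equiv.swap_apply_of_ne_of_ne h1 h2]
        ext x
        simp only [mem_image, mem_univ, true_and, Function.comp_apply]
        rw [himg]
        exact exists_congr fun a => (Equiv.swap_apply_eq_iff).symm
    · refine ⟨_, hswap_inj, hswap_le, g t, mem_image_of_mem _ (mem_univ _), e', hee, heS,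
        by simpa using hmem, ?_⟩
      push Not at hmem
      ext x
      simp only [mem_image, mem_univ, true_and, Function.comp_apply, mem_insert, mem_erase]
      constructor
      · rintro ⟨a, rfl⟩
        by_cases h1 : g a = g t
        · simp [h1]
        · rw [Equiv.swap_apply_of_ne_of_ne h1 (hmem a)]
          exact Or.inr ⟨h1, a, rfl⟩
      · rintro (rfl | ⟨h1, a, rfl⟩)
        · exact ⟨t, by simp⟩
        · exact ⟨a, Equiv.swap_apply_of_ne_of_ne h1 (hmem a)⟩

theorem MoveStep.sum_lt {S B B' : Finset (ℕ × ℕ)} (h : MoveStep S B B') :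
    ∑ x ∈ B, (x.1 + x.2) < ∑ x ∈ B', (x.1 + x.2) := by
  obtain ⟨e, he, e', hee, -, he', rfl⟩ := h
  rw [sum_insert fun h => he' (mem_of_mem_erase h), ← add_sum_erase B _ he]
  rcases hee with rfl | rfl <;> simp only <;> lia

/-- If `g` matches every `t ∈ T ⊆ S` with a position `g t ≤ t`, then the set of these
positions can be shifted in `S` onto `T`. -/
theorem reflTransGen_moveStep_of_matching {S T : Finset (ℕ × ℕ)} (hS : IsLower S)
    (hT : T ⊆ S) (g : T → ℕ × ℕ) (hg : Function.Injective g) (hle : ∀ t, g t ≤ t.1) :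
    Relation.ReflTransGen (MoveStep S) (univ.image g) T := by
  induction hm : ∑ x ∈ S, (x.1 + x.2) - ∑ x ∈ univ.image g, (x.1 + x.2) using
    Nat.strong_induction_on generalizing g with
  | _ m ih =>
    by_cases hfix : ∀ t, g t = t.1
    · have himg : univ.image g = T := by
        ext x
        simp [hfix]
      rw [himg]
    · push Not at hfix
      obtain ⟨t, ht⟩ := hfix
      obtain ⟨g', hg', hle', hstep⟩ := exists_moveStep_of_matching hS hT
        (∑ x ∈ S, (x.1 + x.2)) g hg hle t ht fun s hs =>
          (single_le_sum (f := fun x : ℕ × ℕ => x.1 + x.2) (fun _ _ => Nat.zero_le _) hs).trans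
            (Nat.le_add_left _ _)
      refine Relation.ReflTransGen.head hstep (ih _ ?_ g' hg' hle' rfl)
      have hlt := hstep.sum_lt
      have hsub : univ.image g' ⊆ S := by
        intro x hx
        obtain ⟨s, -, rfl⟩ := mem_image.1 hx
        exact hS _ _ (hT s.2) _ _ (Prod.le_def.1 (hle' s)).1 (Prod.le_def.1 (hle' s)).2
      have := sum_le_sum_of_subset (f := fun x : ℕ × ℕ => x.1 + x.2) hsub
      lia

/-- The lower set of all points of `S` below some point of `T`. -/
theorem isLower_filter_exists_le {S : Finset (ℕ × ℕ)} (hS : IsLower S) (T : Finset (ℕ × ℕ)) :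
    IsLower (S.filter fun x => ∃ t ∈ T, x ≤ t) := by
  intro u v huv i j hi hj
  rw [mem_filter] at huv ⊢
  obtain ⟨hm, t, ht, hle⟩ := huv
  exact ⟨hS _ _ hm _ _ hi hj, t, ht, le_trans (Prod.mk_le_mk.2 ⟨hi, hj⟩) hle⟩

/-- If `A` has at least as many elements as `T` in every lower subset of `S`, then Hall's
theorem matches each `t ∈ T` with a position of `A` below it. -/
theorem exists_matching {S T A : Finset (ℕ × ℕ)} (hS : IsLower S) (hT : T ⊆ S)
    (h : ∀ L ⊆ S, IsLower L → (L ∩ T).card ≤ (L ∩ A).card) :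
    ∃ g : T → ℕ × ℕ, Function.Injective g ∧ ∀ t, g t ∈ A ∧ g t ≤ t.1 := by
  have key := (all_card_le_biUnion_card_iff_exists_injective
    (fun t : T => A.filter fun a => a ≤ t.1)).1 fun s => by
      have hL := h _ (filter_subset _ _)
        (isLower_filter_exists_le hS (s.map (Function.Embedding.subtype _)))
      rw [← card_map (Function.Embedding.subtype _)]
      refine (card_le_card fun x hx => ?_).trans (hL.trans (card_le_card fun x hx => ?_))
      · have hxT : x ∈ T := by
          obtain ⟨t, -, rfl⟩ := mem_map.1 hx
          exact t.2
        exact mem_inter.2 ⟨mem_filter.2 ⟨hT hxT, x, hx, le_rfl⟩, hxT⟩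
      · simp only [mem_inter, mem_filter] at hx
        obtain ⟨⟨-, y, hy, hxy⟩, hxA⟩ := hx
        obtain ⟨t, ht, rfl⟩ := mem_map.1 hy
        exact mem_biUnion.2 ⟨t, ht, mem_filter.2 ⟨hxA, hxy⟩⟩
  obtain ⟨g, hg, hmem⟩ := key
  exact ⟨g, hg, fun t => mem_filter.1 (hmem t)⟩

theorem IsLower.card_le_mul_npq {S : Finset (ℕ × ℕ)} (hS : IsLower S) (p q : ℕ) :
    S.card ≤ (p + 1) * (q + 1) * npq p q S := by
  have h : S.card ≤ ((S.filter fun ab => (p + 1) ∣ ab.1 ∧ (q + 1) ∣ ab.2) ×ˢ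
      (range (p + 1) ×ˢ range (q + 1))).card := by
    refine card_le_card_of_injOn (fun x => (((p + 1) * (x.1 / (p + 1)),
      (q + 1) * (x.2 / (q + 1))), (x.1 % (p + 1), x.2 % (q + 1)))) ?_ ?_
    · intro x hx
      simp only [coe_product, Set.mem_prod, mem_coe, mem_filter, mem_range]
      exact ⟨⟨hS _ _ hx _ _ (Nat.mul_div_le _ _) (Nat.mul_div_le _ _), dvd_mul_right _ _,
        dvd_mul_right _ _⟩, Nat.mod_lt _ p.succ_pos, Nat.mod_lt _ q.succ_pos⟩
    · intro x _ y _ hxy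
      simp only [Prod.mk.injEq] at hxy
      obtain ⟨⟨h1, h2⟩, h3, h4⟩ := hxy
      refine Prod.ext ?_ ?_
      · rw [← Nat.div_add_mod x.1 (p + 1), h1, h3, Nat.div_add_mod]
      · rw [← Nat.div_add_mod x.2 (q + 1), h2, h4, Nat.div_add_mod]
  rw [card_product, card_product, card_range, card_range] at h
  rw [mul_comm]
  exact h

theorem npq_eq_card_inter {L S : Finset (ℕ × ℕ)} (hL : L ⊆ S) (p q : ℕ) :
    npq p q L = (L ∩ S.filter fun ab => (p + 1) ∣ ab.1 ∧ (q + 1) ∣ ab.2).card := by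
  rw [inter_filter, inter_eq_left.2 hL, npq]

/-- the `(p,q)`-Polya inequalities `|L ∩ A| ≥ n_{p,q}(L)` for all
lower `L ⊆ S` hold iff `A ⊆ S` and some shift of `A` in `S` moves `A` onto
`S ∩ Z^{p,q}`. -/
theorem polya_iff_shift (p q : ℕ) (A S : Finset (ℕ × ℕ))
    (hS : IsLower S) (hcard : S.card = (p + 1) * (q + 1) * A.card) :
    (∀ L ⊆ S, IsLower L → npq p q L ≤ (L ∩ A).card) ↔
      (A ⊆ S ∧ Relation.ReflTransGen (MoveStep S) A
        (S.filter fun ab => (p + 1) ∣ ab.1 ∧ (q + 1) ∣ ab.2)) := by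
  constructor
  · intro h
    have hAT : A.card ≤ npq p q S := by
      have := hS.card_le_mul_npq p q
      rw [hcard] at this
      exact Nat.le_of_mul_le_mul_left this (by positivity)
    have hTA := h S Subset.rfl hS
    have hAS : A ⊆ S :=
      inter_eq_right.1 (eq_of_subset_of_card_le inter_subset_right (hAT.trans hTA))
    refine ⟨hAS, ?_⟩
    obtain ⟨g, hg, hmem⟩ := exists_matching (A := A) hS (filter_subset _ _)
      fun L hL hLl => (npq_eq_card_inter hL p q).symm.trans_le (h L hL hLl)
    have himg : univ.image g = A := by
      refine eq_of_subset_of_card_le (image_subset_iff.2 fun t _ => (hmem t).1) ?_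
      rw [card_image_of_injective _ hg, card_univ, Fintype.card_coe]
      exact hAT
    have := reflTransGen_moveStep_of_matching hS (filter_subset _ _) g hg fun t => (hmem t).2
    rwa [himg] at this
  · rintro ⟨-, hshift⟩ L hL hLl
    rw [npq_eq_card_inter hL]
    generalize (S.filter fun ab => (p + 1) ∣ ab.1 ∧ (q + 1) ∣ ab.2) = T at hshift ⊢
    induction hshift with
    | refl => exact le_rfl
    | tail _ hstep ih => exact (hstep.card_inter_le hLl).trans ih
end
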